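/- Let S ~ Bernoulli(p) with p ∈ (0,1) and p̄ := 1 − p, suppose the conditional distribution of X given S = s is N(μ_s, σ_s² I_d) for s ∈ {0,1} with μ_s ∈ ℝ^d and σ_s > 0, let σ > 0, let X^σ := X + σZ with Z ~ N(0, I_d) independent of (X, S), let η^σ(x) := E[S | X^σ = x], and let ε_A := inf over functions of the form x ↦ s(aᵀx + β) (a ∈ ℝ^d, β ∈ ℝ, s(z) = 1/(1+e^{−z})) of E[(η^σ(X^σ) − h(X^σ))²]. Write Δ := ‖μ_1 − μ_0‖². Then ε_A ≤ (σ_1² − σ_0²)² (q_1 + q_2σ² + q_3σ⁴ + 2dσ⁶) / (16(r_1 + r_2σ² + r_3σ⁴ + r_4σ⁶ + r_5σ⁸ + σ¹⁰)), where q_1 = Δ²(p²p̄σ_1² + p p̄²σ_0²) + 2dσ_0⁶ − d²p³(σ_1² − σ_0²)³ + 2p p̄(2+d)σ_0²σ_1²Δ + p²(d(5d−2)σ_0⁴σ_1² − 2d(2d+1)σ_0²σ_1⁴ + d(2+d)σ_1⁶ − 2d(d−1)σ_0⁶) + p(d(d−4)σ_0⁶ − 2d(d−1)σ_0⁴σ_1²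 + d(2+d)σ_0²σ_1⁴); q_2 = p p̄ Δ(Δ + 2(2+d)(σ_0² + σ_1²)) − p²d(d−4)(σ_1² − σ_0²)² + p(d(d−10)σ_0⁴ − 2d(d−4)σ_0²σ_1² + d(2+d)σ_1⁴) + 6dσ_0⁴; q_3 = 2p p̄(2+d)Δ + 6d(pσ_1² + p̄σ_0²); r_1 = σ_0⁴σ_1⁴(p p̄ Δ + pσ_1² + p̄σ_0²); r_2 = σ_0²σ_1²(2p p̄(σ_1² + σ_0²)Δ + 2pσ_1⁴ + 2p̄σ_0⁴ + 3σ_0²σ_1²); r_3 = p p̄(σ_0⁴ + 4σ_0²σ_1² + σ_1⁴)Δ + pσ_1⁶ + 3(1+p)σ_0²σ_1⁴ + 3(2−p)σ_0⁴σ_1² + p̄σ_0⁶; r_4 = 2p p̄(σ_1² + σ_0²)Δ + (2p+1)σ_1⁴ + (3−2p)σ_0⁴ + 6σ_0²σ_1²; and r_5 = p p̄ Δ + (3−p)σ_0² + (2+p)σ_1². -/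

import Mathlib

open MeasureTheory ProbabilityTheory Matrix

/-- The `N(m, C)` Lebesgue density on `ℝ^d`. -/
noncomputable def gaussDensity {d : ℕ} (m : Fin d → ℝ) (C : Matrix (Fin d) (Fin d) ℝ)
    (x : Fin d → ℝ) : ℝ :=
  (Real.sqrt ((2 * Real.pi) ^ d * C.det))⁻¹ *
    Real.exp (-(1 / 2) * ((x - m) ⬝ᵥ (C⁻¹ *ᵥ (x - m))))

open scoped NNReal ENNReal

lemma gaussDensity_smul_one {d : ℕ} (m : Fin d → ℝ) {v : ℝ≥0} (hv : v ≠ 0)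
    (x : Fin d → ℝ) :
    gaussDensity m ((v : ℝ) • (1 : Matrix (Fin d) (Fin d) ℝ)) x
      = ∏ i, gaussianPDFReal (m i) v (x i) := by
  have hv' : (v : ℝ) ≠ 0 := NNReal.coe_ne_zero.2 hv
  have hinv : ((v : ℝ) • (1 : Matrix (Fin d) (Fin d) ℝ))⁻¹ = (v : ℝ)⁻¹ • 1 :=
    Matrix.inv_eq_left_inv (by simp [smul_smul, hv'])
  unfold gaussDensity
  simp only [gaussianPDFReal]
  rw [Finset.prod_mul_distrib, ← Real.exp_sum, hinv, Matrix.det_smul, Matrix.det_one,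
    Finset.prod_const, Finset.card_univ, Fintype.card_fin, mul_one, ← mul_pow,
    Real.sqrt_eq_rpow, Real.sqrt_eq_rpow, inv_pow, ← Real.rpow_natCast, ← Real.rpow_natCast,
    ← Real.rpow_mul (by positivity), ← Real.rpow_mul (by positivity), mul_comm (d : ℝ)]
  congr 2
  simp only [dotProduct, Matrix.smul_mulVec, Matrix.one_mulVec, Pi.smul_apply, smul_eq_mul,
    Pi.sub_apply, Finset.mul_sum]
  refine Finset.sum_congr rfl fun i _ ↦ ?_
  field_simp

lemma pi_gaussianReal_eq_withDensity {d : ℕ} (m : Fin d → ℝ) {v : ℝ≥0} (hv : v ≠ 0) :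
    Measure.pi (fun i ↦ gaussianReal (m i) v)
      = volume.withDensity fun x ↦
          ENNReal.ofReal (gaussDensity m ((v : ℝ) • (1 : Matrix (Fin d) (Fin d) ℝ)) x) := by
  simp only [gaussDensity_smul_one m hv]
  refine Measure.pi_eq fun s hs ↦ ?_
  have hint (i : Fin d) :
      Integrable ((s i).indicator (gaussianPDFReal (m i) v)) :=
    (integrable_gaussianPDFReal (m i) v).indicator (hs i)
  have hind (x : Fin d → ℝ) :
      (Set.univ.pi s).indicator (fun x ↦ ENNReal.ofReal (∏ i, gaussianPDFReal (m i) v (x i))) x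
        = ENNReal.ofReal (∏ i, (s i).indicator (gaussianPDFReal (m i) v) (x i)) := by
    by_cases hx : x ∈ Set.univ.pi s
    · rw [Set.indicator_of_mem hx]
      congr 1
      exact Finset.prod_congr rfl fun i _ ↦ by
        rw [Set.indicator_of_mem (hx i (Set.mem_univ i))]
    · rw [Set.indicator_of_notMem hx]
      simp only [Set.mem_univ_pi, not_forall] at hx
      obtain ⟨i, hi⟩ := hx
      rw [Finset.prod_eq_zero (Finset.mem_univ i) (Set.indicator_of_notMem hi _),
        ENNReal.ofReal_zero]
  rw [withDensity_apply _ (.univ_pi hs), ← lintegral_indicator (.univ_pi hs)]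
  simp only [hind]
  rw [← ofReal_integral_eq_lintegral_ofReal]
  · rw [volume_pi, integral_fintype_prod_eq_prod, ENNReal.ofReal_prod_of_nonneg]
    · refine Finset.prod_congr rfl fun i _ ↦ ?_
      rw [integral_indicator (hs i), gaussianReal_apply_eq_integral _ hv]
    · exact fun i _ ↦ integral_nonneg fun x ↦
        Set.indicator_nonneg (fun _ _ ↦ gaussianPDFReal_nonneg _ _ _) _
  · exact Integrable.fintype_prod hint
  · exact ae_of_all _ fun x ↦ Finset.prod_nonneg fun i _ ↦
      Set.indicator_nonneg (fun _ _ ↦ gaussianPDFReal_nonneg _ _ _) _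

lemma map_add_smul_pi_gaussianReal {d : ℕ} (m : Fin d → ℝ) (v : ℝ≥0) (σ : ℝ) :
    ((Measure.pi fun i ↦ gaussianReal (m i) v).prod
        (Measure.pi fun _ : Fin d ↦ gaussianReal 0 1)).map (fun z ↦ z.1 + σ • z.2)
      = Measure.pi fun i ↦ gaussianReal (m i) (v + .mk (σ ^ 2) (sq_nonneg σ)) := by
  have h1 (i : Fin d) : ((gaussianReal (m i) v).prod (gaussianReal 0 1)).map
      (fun z ↦ z.1 + σ * z.2) = gaussianReal (m i) (v + .mk (σ ^ 2) (sq_nonneg σ)) := by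
    have hz : ((gaussianReal (m i) v).prod (gaussianReal 0 1)).map (fun z ↦ σ * z.2)
        = gaussianReal 0 (.mk (σ ^ 2) (sq_nonneg σ)) := by
      rw [← Function.comp_def (fun x ↦ σ * x) Prod.snd, ← Measure.map_map (by fun_prop)
        (by fun_prop), ← Measure.snd, Measure.snd_prod, gaussianReal_map_const_mul]
      simp

    have hx : ((gaussianReal (m i) v).prod (gaussianReal 0 1)).map Prod.fst
        = gaussianReal (m i) v := by
      rw [← Measure.fst, Measure.fst_prod]
    have := gaussianReal_add_gaussianReal_of_indepFun
      (indepFun_prod (μ := gaussianReal (m i) v) (ν := gaussianReal 0 1)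
        (X := fun x ↦ x) (Y := fun x ↦ σ * x) (by fun_prop) (by fun_prop)) hx hz
    rw [add_zero] at this
    exact this
  rw [← (measurePreserving_arrowProdEquivProdArrow ℝ ℝ (Fin d)
      (fun i ↦ gaussianReal (m i) v) (fun _ ↦ gaussianReal 0 1)).map_eq,
    Measure.map_map (by fun_prop) (MeasurableEquiv.measurable _)]
  simp_rw [← h1]
  rw [← Measure.pi_map_pi (by fun_prop)]
  rfl

lemma integral_pow_three_gaussianReal (v : ℝ≥0) : ∫ x, x ^ 3 ∂(gaussianReal 0 v) = 0 := by
  have h := gaussianReal_map_neg (μ := 0) (v := v)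
  rw [neg_zero] at h
  have h2 : ∫ x, x ^ 3 ∂(gaussianReal 0 v) = ∫ x, (-x) ^ 3 ∂(gaussianReal 0 v) := by
    conv_lhs => rw [← h]
    rw [integral_map (by fun_prop) (by fun_prop)]
  have h3 (x : ℝ) : (-x) ^ 3 = -x ^ 3 := by ring
  simp only [h3, integral_neg] at h2
  linarith

lemma integral_pow_four_gaussianReal (v : ℝ≥0) :
    ∫ x, x ^ 4 ∂(gaussianReal 0 v) = 3 * (v : ℝ) ^ 2 := by
  have h := iteratedDeriv_mgf_zero (X := fun x : ℝ ↦ x) (μ := gaussianReal 0 v) (by simp) 4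
  have step (P P' Q : ℝ → ℝ) (hP : ∀ t, HasDerivAt P (P' t) t)
      (hQ : ∀ t, P' t + v * t * P t = Q t) :
      deriv (fun t ↦ P t * Real.exp (v * t ^ 2 / 2))
        = fun t ↦ Q t * Real.exp (v * t ^ 2 / 2) := by
    ext t
    have h2 : HasDerivAt (fun t : ℝ ↦ (v : ℝ) * t ^ 2 / 2) (v * t) t :=
      (((hasDerivAt_pow 2 t).const_mul (v : ℝ)).div_const 2).congr_deriv (by ring)
    rw [((hP t).fun_mul h2.exp).deriv, ← hQ]
    ring
  have d0 : mgf (fun x : ℝ ↦ x) (gaussianReal 0 v)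
      = fun t ↦ (fun _ ↦ (1 : ℝ)) t * Real.exp (v * t ^ 2 / 2) := by
    rw [mgf_fun_id_gaussianReal]; ext t; simp
  rw [iteratedDeriv_succ', iteratedDeriv_succ', iteratedDeriv_succ', iteratedDeriv_one, d0,
    step _ (fun _ ↦ 0) (fun t ↦ v * t) (fun t ↦ hasDerivAt_const _ _) (fun t ↦ by ring),
    step _ (fun _ ↦ v) (fun t ↦ v + v ^ 2 * t ^ 2)
      (fun t ↦ by simpa using (hasDerivAt_id t).const_mul (v : ℝ)) (fun t ↦ by ring),
    step _ (fun t ↦ 2 * v ^ 2 * t) (fun t ↦ 3 * v ^ 2 * t + v ^ 3 * t ^ 3)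
      (fun t ↦ (((hasDerivAt_pow 2 t).const_mul ((v : ℝ) ^ 2)).const_add (v : ℝ)).congr_deriv
        (by ring)) (fun t ↦ by ring),
    step _ (fun t ↦ 3 * v ^ 2 + 3 * v ^ 3 * t ^ 2)
      (fun t ↦ 3 * v ^ 2 + 3 * v ^ 3 * t ^ 2 + v * t * (3 * v ^ 2 * t + v ^ 3 * t ^ 3))
      (fun t ↦ (((hasDerivAt_id' t).const_mul (3 * (v : ℝ) ^ 2)).fun_add
        ((hasDerivAt_pow 3 t).const_mul ((v : ℝ) ^ 3))).congr_deriv (by norm_num; ring))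
      (fun t ↦ rfl)] at h
  simpa using h.symm

lemma memLp_pow_gaussianReal (v : ℝ≥0) (n : ℕ) :
    MemLp (fun x : ℝ ↦ x ^ n) 2 (gaussianReal 0 v) := by
  rw [memLp_two_iff_integrable_sq (by fun_prop)]
  simp_rw [← pow_mul]
  have h := (memLp_id_gaussianReal' (μ := 0) (v := v) ((n * 2 : ℕ) : ℝ≥0∞)
    (ENNReal.natCast_ne_top _)).integrable_norm_pow'
  have h2 := integrable_norm_iff (f := fun x : ℝ ↦ x ^ (n * 2)) (μ := gaussianReal 0 v)
    (by fun_prop)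
  simp only [norm_pow] at h2
  exact h2.1 h

lemma memLp_sq_add_mul_gaussianReal (v : ℝ≥0) (b : ℝ) :
    MemLp (fun x : ℝ ↦ x ^ 2 + b * x) 2 (gaussianReal 0 v) := by
  have h := (memLp_pow_gaussianReal v 2).add ((memLp_pow_gaussianReal v 1).const_mul b)
  simp only [pow_one] at h
  exact h

lemma integrable_pow_gaussianReal (v : ℝ≥0) (n : ℕ) :
    Integrable (fun x : ℝ ↦ x ^ n) (gaussianReal 0 v) :=
  (memLp_pow_gaussianReal v n).integrable (by norm_num)

lemma integral_sq_gaussianReal (v : ℝ≥0) : ∫ x, x ^ 2 ∂(gaussianReal 0 v) = v := by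
  have h := variance_fun_id_gaussianReal (μ := 0) (v := v)
  simpa [variance_eq_integral (aemeasurable_id'), integral_id_gaussianReal] using h

lemma integral_sq_add_mul_gaussianReal (v : ℝ≥0) (b : ℝ) :
    ∫ x, x ^ 2 + b * x ∂(gaussianReal 0 v) = v := by
  have h1 : Integrable (fun x : ℝ ↦ x) (gaussianReal 0 v) := by
    simpa using integrable_pow_gaussianReal v 1
  rw [integral_add (integrable_pow_gaussianReal v 2) (h1.const_mul b),
    integral_const_mul, integral_sq_gaussianReal, integral_id_gaussianReal]
  simp

lemma variance_sq_add_mul_gaussianReal (v : ℝ≥0) (b : ℝ) :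
    Var[fun x ↦ x ^ 2 + b * x; gaussianReal 0 v] = 2 * (v : ℝ) ^ 2 + b ^ 2 * v := by
  have h (x : ℝ) : (x ^ 2 + b * x) ^ 2 = x ^ 4 + 2 * b * x ^ 3 + b ^ 2 * x ^ 2 := by ring
  rw [variance_eq_sub (memLp_sq_add_mul_gaussianReal v b), integral_sq_add_mul_gaussianReal]
  simp only [Pi.pow_apply, h]
  rw [integral_add (((integrable_pow_gaussianReal v 4)).fun_add
      ((integrable_pow_gaussianReal v 3).const_mul _))
      ((integrable_pow_gaussianReal v 2).const_mul _),
    integral_add (integrable_pow_gaussianReal v 4)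
      ((integrable_pow_gaussianReal v 3).const_mul _),
    integral_const_mul, integral_const_mul, integral_sq_gaussianReal,
    integral_pow_three_gaussianReal, integral_pow_four_gaussianReal]
  ring

lemma memLp_quadratic_pi_gaussianReal {d : ℕ} (v : ℝ≥0) (b : Fin d → ℝ) (κ : ℝ) :
    MemLp (fun y : Fin d → ℝ ↦ ∑ i, (y i ^ 2 + b i * y i) + κ) 2
      (Measure.pi fun _ ↦ gaussianReal 0 v) :=
  (memLp_finsetSum _ fun i _ ↦ (memLp_sq_add_mul_gaussianReal v (b i)).comp_measurePreserving
    (measurePreserving_eval (fun _ : Fin d ↦ gaussianReal 0 v) i)).add (memLp_const κ)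

lemma integral_quadratic_sq_pi_gaussianReal {d : ℕ} (v : ℝ≥0) (b : Fin d → ℝ) (κ : ℝ) :
    ∫ y : Fin d → ℝ, (∑ i, (y i ^ 2 + b i * y i) + κ) ^ 2
        ∂(Measure.pi fun _ ↦ gaussianReal 0 v)
      = (d * v + κ) ^ 2 + 2 * d * (v : ℝ) ^ 2 + (b ⬝ᵥ b) * v := by
  set P : Measure (Fin d → ℝ) := Measure.pi fun _ ↦ gaussianReal 0 v
  have hF (i : Fin d) : MemLp (fun y : Fin d → ℝ ↦ y i ^ 2 + b i * y i) 2 P :=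
    (memLp_sq_add_mul_gaussianReal v (b i)).comp_measurePreserving
      (measurePreserving_eval (fun _ : Fin d ↦ gaussianReal 0 v) i)
  have hsum : MemLp (fun y : Fin d → ℝ ↦ ∑ i, (y i ^ 2 + b i * y i)) 2 P :=
    memLp_finsetSum _ fun i _ ↦ hF i
  have hmean : ∫ y, ∑ i, (y i ^ 2 + b i * y i) + κ ∂P = d * v + κ := by
    rw [integral_add (hsum.integrable (by norm_num)) (integrable_const κ),
      integral_finsetSum _ fun i _ ↦ (hF i).integrable (by norm_num)]
    have (i : Fin d) : ∫ y, y i ^ 2 + b i * y i ∂P = v := by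
      rw [← integral_sq_add_mul_gaussianReal v (b i)]
      exact integral_comp_eval (μ := fun _ : Fin d ↦ gaussianReal 0 v) (i := i)
        (f := fun x ↦ x ^ 2 + b i * x) (by fun_prop)
    simp [this]
  have hvar := variance_sum_pi (μ := fun _ : Fin d ↦ gaussianReal 0 v)
    (fun i ↦ memLp_sq_add_mul_gaussianReal v (b i))
  have hv := variance_eq_sub (memLp_quadratic_pi_gaussianReal v b κ)
  rw [hmean, variance_add_const (by fun_prop)] at hv
  have hfun : (∑ i, fun y : Fin d → ℝ ↦ y i ^ 2 + b i * y i)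
      = fun y ↦ ∑ i, (y i ^ 2 + b i * y i) := by
    ext y; simp
  rw [hfun, hv] at hvar
  simp only [variance_sq_add_mul_gaussianReal, Finset.sum_add_distrib, Finset.sum_const,
    Finset.card_univ, Fintype.card_fin, nsmul_eq_mul, ← Finset.sum_mul] at hvar
  have hb : b ⬝ᵥ b = ∑ i, b i ^ 2 := by simp [dotProduct, sq]
  rw [hb]
  simp only [Pi.pow_apply] at hvar
  simp only [Finset.sum_add_distrib]
  linarith

lemma pi_gaussianReal_map_add {d : ℕ} (m : Fin d → ℝ) (v : ℝ≥0) :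
    (Measure.pi fun _ : Fin d ↦ gaussianReal 0 v).map (fun y ↦ y + m)
      = Measure.pi fun i ↦ gaussianReal (m i) v := by
  have h (i : Fin d) : (gaussianReal 0 v).map (· + m i) = gaussianReal (m i) v := by
    rw [gaussianReal_map_add_const, zero_add]
  simp_rw [← h]
  rw [← Measure.pi_map_pi (by fun_prop)]
  rfl

lemma sigmoid_sub_sq_le (a b : ℝ) :
    (Real.sigmoid a - Real.sigmoid b) ^ 2 ≤ 1 / 4 * (a - b) ^ 2 := by
  have h := convex_univ.norm_image_sub_le_of_norm_hasDerivWithin_le (f := Real.sigmoid)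
    (C := 1 / 2) (fun x _ ↦ (Real.hasDerivAt_sigmoid x).hasDerivWithinAt)
    (fun x _ ↦ by
      have h0 := Real.sigmoid_pos x
      have h1 := Real.sigmoid_lt_one x
      rw [Real.norm_eq_abs, abs_le]
      constructor <;> nlinarith [sq_nonneg (Real.sigmoid x - 1 / 2)])
    (Set.mem_univ b) (Set.mem_univ a)
  rw [Real.norm_eq_abs, Real.norm_eq_abs] at h
  calc (Real.sigmoid a - Real.sigmoid b) ^ 2
      = |Real.sigmoid a - Real.sigmoid b| ^ 2 := (sq_abs _).symm
    _ ≤ (1 / 2 * |a - b|) ^ 2 := by gcongr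
    _ = 1 / 4 * (a - b) ^ 2 := by rw [mul_pow, sq_abs]; norm_num

lemma map_prodMk_cond_of_indepFun {Ω E F G : Type*} [MeasurableSpace Ω] [MeasurableSpace E]
    [MeasurableSpace F] [MeasurableSpace G] {μ : Measure Ω} [IsProbabilityMeasure μ]
    {X : Ω → E} {S : Ω → G} {Z : Ω → F} (hX : Measurable X) (hS : Measurable S)
    (hZ : Measurable Z) (hind : IndepFun Z (fun ω ↦ (X ω, S ω)) μ) {T : Set G}
    (hT : MeasurableSet T) :
    (μ[|S ⁻¹' T]).map (fun ω ↦ (X ω, Z ω))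
      = ((μ[|S ⁻¹' T]).map X).prod (μ.map Z) := by
  have := Measure.isProbabilityMeasure_map (μ := μ) hZ.aemeasurable
  refine (Measure.prod_eq fun s t hs ht ↦ ?_).symm
  have h := hind.measure_inter_preimage_eq_mul t (s ×ˢ T) ht (hs.prod hT)
  have e1 : (fun ω ↦ (X ω, S ω)) ⁻¹' (s ×ˢ T) = S ⁻¹' T ∩ X ⁻¹' s := by
    ext ω; simp [and_comm]
  have e2 : (fun ω ↦ (X ω, Z ω)) ⁻¹' (s ×ˢ t) = X ⁻¹' s ∩ Z ⁻¹' t := by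
    ext ω; simp
  rw [Measure.map_apply (by fun_prop) (hs.prod ht), Measure.map_apply hX hs,
    Measure.map_apply hZ ht, cond_apply (hS hT), cond_apply (hS hT), e2,
    ← Set.inter_assoc, Set.inter_comm _ (Z ⁻¹' t), ← e1, h, mul_comm (μ _) (μ _), mul_assoc]

lemma map_add_smul_cond {Ω : Type*} [MeasurableSpace Ω] {μ : Measure Ω}
    [IsProbabilityMeasure μ] {d : ℕ} {X Z : Ω → Fin d → ℝ} {S : Ω → ℝ} (hX : Measurable X)
    (hS : Measurable S) (hZ : Measurable Z)
    (hZlaw : μ.map Z = Measure.pi fun _ : Fin d ↦ gaussianReal 0 1)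
    (hind : IndepFun Z (fun ω ↦ (X ω, S ω)) μ) {m : Fin d → ℝ} {s : ℝ} (hs : 0 < s) {c : ℝ}
    (hlaw : (μ[|{ω | S ω = c}]).map X = volume.withDensity fun x ↦
      ENNReal.ofReal (gaussDensity m (s ^ 2 • (1 : Matrix (Fin d) (Fin d) ℝ)) x)) (σ : ℝ) :
    (μ[|{ω | S ω = c}]).map (fun ω ↦ X ω + σ • Z ω)
      = Measure.pi fun i ↦ gaussianReal (m i)
          (.mk (s ^ 2) (sq_nonneg s) + .mk (σ ^ 2) (sq_nonneg σ)) := by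
  have hv : NNReal.mk (s ^ 2) (sq_nonneg s) ≠ 0 := by
    rw [← NNReal.coe_ne_zero]; exact (pow_pos hs 2).ne'
  have h := map_prodMk_cond_of_indepFun hX hS hZ hind (measurableSet_singleton c)
  change (μ[|{ω | S ω = c}]).map _ = ((μ[|{ω | S ω = c}]).map X).prod _ at h
  rw [hlaw, hZlaw] at h
  have hpi := pi_gaussianReal_eq_withDensity m hv
  rw [NNReal.coe_mk] at hpi
  rw [← hpi] at h
  rw [← map_add_smul_pi_gaussianReal, ← h, Measure.map_map (by fun_prop) (by fun_prop)]
  rfl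

lemma map_eq_mixture {Ω E : Type*} [MeasurableSpace Ω] [MeasurableSpace E] {μ : Measure Ω}
    [IsProbabilityMeasure μ] {S : Ω → ℝ} (hS : Measurable S) (hS01 : ∀ ω, S ω = 0 ∨ S ω = 1)
    {p : ℝ} (hp : p ∈ Set.Ioo (0 : ℝ) 1) (hSlaw : μ {ω | S ω = 1} = ENNReal.ofReal p)
    {Y : Ω → E} (hY : Measurable Y) :
    μ.map Y = ENNReal.ofReal p • (μ[|{ω | S ω = 1}]).map Y
      + ENNReal.ofReal (1 - p) • (μ[|{ω | S ω = 0}]).map Y := by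
  have hm1 : MeasurableSet {ω | S ω = 1} := hS (measurableSet_singleton 1)
  have hcompl : {ω | S ω = 1}ᶜ = {ω | S ω = 0} := by
    ext ω
    rcases hS01 ω with h | h <;> simp [h]
  have hS0 : μ {ω | S ω = 0} = ENNReal.ofReal (1 - p) := by
    rw [← hcompl, prob_compl_eq_one_sub hm1, hSlaw, ENNReal.ofReal_sub _ hp.1.le,
      ENNReal.ofReal_one]
  ext B hB
  have h := cond_add_cond_compl_eq (μ := μ) (t := Y ⁻¹' B) hm1
  simp only [Measure.add_apply, Measure.smul_apply, smul_eq_mul, Measure.map_apply hY hB]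
  rw [← h, hcompl, hSlaw, hS0]
  ring

lemma ae_eq_condExp_of_bayes {Ω E : Type*} [MeasurableSpace Ω] [MeasurableSpace E]
    {μ : Measure Ω} [IsProbabilityMeasure μ] {S : Ω → ℝ} (hS : Measurable S)
    (hS01 : ∀ ω, S ω = 0 ∨ S ω = 1) {p : ℝ} (hp : p ∈ Set.Ioo (0 : ℝ) 1)
    (hSlaw : μ {ω | S ω = 1} = ENNReal.ofReal p) {Y : Ω → E} (hY : Measurable Y)
    {ρ : Measure E} {f0 f1 : E → ℝ≥0∞} (hf0 : Measurable f0) (hf1 : Measurable f1)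
    (h0 : (μ[|{ω | S ω = 0}]).map Y = ρ.withDensity f0)
    (h1 : (μ[|{ω | S ω = 1}]).map Y = ρ.withDensity f1)
    {h : E → ℝ} (hh : Measurable h) (hh0 : ∀ x, 0 ≤ h x) (hh1 : ∀ x, h x ≤ 1)
    (hbayes : ∀ x, (ENNReal.ofReal p * f1 x + ENNReal.ofReal (1 - p) * f0 x)
      * ENNReal.ofReal (h x) = ENNReal.ofReal p * f1 x) :
    (fun ω ↦ h (Y ω)) =ᵐ[μ] μ[S | MeasurableSpace.comap Y inferInstance] := by
  have hm1 : MeasurableSet {ω | S ω = 1} := hS (measurableSet_singleton 1)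
  have hSind : S = {ω | S ω = 1}.indicator 1 := by
    ext ω
    rcases hS01 ω with h | h <;> simp [h]
  have hSint : Integrable S μ := by
    rw [hSind]
    exact (integrable_const 1).indicator hm1
  have hhint : Integrable (fun ω ↦ h (Y ω)) μ :=
    .of_bound (hh.comp hY).aestronglyMeasurable 1
      (ae_of_all _ fun ω ↦ by rw [Real.norm_of_nonneg (hh0 _)]; exact hh1 _)
  refine ae_eq_condExp_of_forall_setIntegral_eq hY.comap_le hSint
    (fun s _ _ ↦ hhint.integrableOn) ?_
    (hh.comp (comap_measurable Y)).stronglyMeasurable.aestronglyMeasurable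
  rintro _ ⟨B, hB, rfl⟩ -
  have hν : μ.map Y = ρ.withDensity
      (fun x ↦ ENNReal.ofReal p * f1 x + ENNReal.ofReal (1 - p) * f0 x) := by
    rw [map_eq_mixture hS hS01 hp hSlaw hY, h0, h1, ← withDensity_smul _ hf1,
      ← withDensity_smul _ hf0, ← withDensity_add_left (hf1.const_smul _)]
    rfl
  have hS' : ∫ ω in Y ⁻¹' B, S ω ∂μ = (μ ({ω | S ω = 1} ∩ Y ⁻¹' B)).toReal := by
    conv_lhs => rw [hSind]
    rw [integral_indicator_one hm1, measureReal_restrict_apply hm1]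
    rfl
  rw [hS', ← setIntegral_map hB hh.aestronglyMeasurable hY.aemeasurable,
    integral_eq_lintegral_of_nonneg_ae (ae_of_all _ hh0) hh.aestronglyMeasurable]
  congr 1
  rw [hν, setLIntegral_withDensity_eq_setLIntegral_mul _ (by fun_prop) (by fun_prop) hB]
  simp only [Pi.mul_apply, hbayes]
  rw [lintegral_const_mul _ hf1, ← withDensity_apply _ hB, ← h1, Measure.map_apply hY hB,
    ← hSlaw, mul_comm, cond_mul_eq_inter hm1]

lemma integral_residual_sq_pi_gaussianReal {d : ℕ} (v : ℝ≥0) (m δ : Fin d → ℝ) (a c e : ℝ) :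
    Integrable (fun x ↦ ((x - m) ⬝ᵥ (x - m) - c * (δ ⬝ᵥ (x - m)) - e) ^ 2)
        (Measure.pi fun i ↦ gaussianReal ((m + a • δ) i) v) ∧
      ∫ x, ((x - m) ⬝ᵥ (x - m) - c * (δ ⬝ᵥ (x - m)) - e) ^ 2
          ∂(Measure.pi fun i ↦ gaussianReal ((m + a • δ) i) v)
        = (d * v + ((a ^ 2 - c * a) * (δ ⬝ᵥ δ) - e)) ^ 2 + 2 * d * (v : ℝ) ^ 2
          + (2 * a - c) ^ 2 * (δ ⬝ᵥ δ) * v := by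
  have key (y : Fin d → ℝ) :
      (y + (m + a • δ) - m) ⬝ᵥ (y + (m + a • δ) - m)
          - c * (δ ⬝ᵥ (y + (m + a • δ) - m)) - e
        = ∑ i, (y i ^ 2 + ((2 * a - c) • δ) i * y i) + ((a ^ 2 - c * a) * (δ ⬝ᵥ δ) - e) := by
    have h : y + (m + a • δ) - m = y + a • δ := by abel
    rw [h]
    simp only [dotProduct, Finset.mul_sum, add_sub, ← Finset.sum_sub_distrib,
      ← Finset.sum_add_distrib, Pi.add_apply, Pi.smul_apply, smul_eq_mul]
    congr 1
    exact Finset.sum_congr rfl fun i _ ↦ by ring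
  rw [← pi_gaussianReal_map_add, integrable_map_measure (by fun_prop) (by fun_prop),
    integral_map (by fun_prop) (by fun_prop)]
  constructor
  · simp only [Function.comp_def, key]
    exact (memLp_quadratic_pi_gaussianReal v _ _).integrable_sq
  · simp only [key]
    rw [integral_quadratic_sq_pi_gaussianReal]
    simp only [dotProduct_smul, smul_dotProduct, smul_eq_mul]
    ring

lemma gaussDensity_smul_one_eq_exp {d : ℕ} (m : Fin d → ℝ) {v : ℝ} (hv : 0 < v)
    (x : Fin d → ℝ) :
    gaussDensity m (v • (1 : Matrix (Fin d) (Fin d) ℝ)) x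
      = (√((2 * Real.pi) ^ d * v ^ d))⁻¹
        * Real.exp (-((x - m) ⬝ᵥ (x - m) / (2 * v))) := by
  have hinv : (v • (1 : Matrix (Fin d) (Fin d) ℝ))⁻¹ = v⁻¹ • 1 :=
    Matrix.inv_eq_left_inv (by simp [smul_smul, hv.ne'])
  unfold gaussDensity
  rw [hinv, Matrix.det_smul, Matrix.det_one, Fintype.card_fin, mul_one, Matrix.smul_mulVec,
    Matrix.one_mulVec, dotProduct_smul, smul_eq_mul]
  congr 2
  field_simp

lemma sigmoid_log_sub_add {a b u w : ℝ} (ha : 0 < a) (hb : 0 < b) :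
    (a * Real.exp (-u) + b * Real.exp (-w)) * Real.sigmoid (Real.log a - Real.log b + w - u)
      = a * Real.exp (-u) := by
  have h : Real.exp (-(Real.log a - Real.log b + w - u))
      = b * Real.exp (-w) / (a * Real.exp (-u)) := by
    rw [eq_div_iff (by positivity)]
    nth_rewrite 2 [← Real.exp_log ha]
    nth_rewrite 2 [← Real.exp_log hb]
    rw [← Real.exp_add, ← Real.exp_add, ← Real.exp_add]
    congr 1
    ring
  rw [Real.sigmoid_def, h]
  have := Real.exp_pos (-u)
  have := Real.exp_pos (-w)
  field_simp

lemma residual_variance_eq_bound {p d D A B t c e : ℝ} (hp : p ∈ Set.Ioo (0 : ℝ) 1)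
    (hD : 0 ≤ D) (hA : 0 < A) (hB : 0 < B) (ht : 0 < t)
    (hc : c = p * (1 - p) * ((1 - 2 * p) * D + (d + 2) * (B - A))
      / (p * (B + t) + (1 - p) * (A + t) + p * (1 - p) * D))
    (he : e = p * ((1 - p) ^ 2 * D + d * (B + t)) + (1 - p) * (p ^ 2 * D + d * (A + t))) :
    1 / 4 * (1 / 2 * (1 / (A + t) - 1 / (B + t))) ^ 2 *
      (p * ((d * (B + t) + (((1 - p) ^ 2 - c * (1 - p)) * D - e)) ^ 2 + 2 * d * (B + t) ^ 2
          + (2 * (1 - p) - c) ^ 2 * D * (B + t))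
        + (1 - p) * ((d * (A + t) + (((-p) ^ 2 - c * (-p)) * D - e)) ^ 2 + 2 * d * (A + t) ^ 2
          + (2 * (-p) - c) ^ 2 * D * (A + t)))
    = (B - A) ^ 2 * ((p * (2 * d * (B + t) ^ 2 + 4 * (B + t) * (1 - p) ^ 2 * D)
          + (1 - p) * (2 * d * (A + t) ^ 2 + 4 * (A + t) * p ^ 2 * D)
          + p * (1 - p) * ((1 - 2 * p) * D + d * (B - A)) ^ 2)
            * (p * (B + t) + (1 - p) * (A + t) + p * (1 - p) * D)
          - (p * (1 - p)) ^ 2 * D * ((1 - 2 * p) * D + (d + 2) * (B - A)) ^ 2)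
      / (16 * ((A + t) ^ 2 * (B + t) ^ 2
          * (p * (B + t) + (1 - p) * (A + t) + p * (1 - p) * D))) := by
  obtain ⟨hp0, hp1⟩ := hp
  have hq : 0 < 1 - p := by linarith
  have hV : 0 < p * (B + t) + (1 - p) * (A + t) + p * (1 - p) * D := by positivity
  have hAt : 0 < A + t := by positivity
  have hBt : 0 < B + t := by positivity
  set V := p * (B + t) + (1 - p) * (A + t) + p * (1 - p) * D with hVdef
  have h1 : (p * ((d * (B + t) + (((1 - p) ^ 2 - c * (1 - p)) * D - e)) ^ 2
          + 2 * d * (B + t) ^ 2 + (2 * (1 - p) - c) ^ 2 * D * (B + t))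
        + (1 - p) * ((d * (A + t) + (((-p) ^ 2 - c * (-p)) * D - e)) ^ 2 + 2 * d * (A + t) ^ 2
          + (2 * (-p) - c) ^ 2 * D * (A + t)))
      = (p * (2 * d * (B + t) ^ 2 + 4 * (B + t) * (1 - p) ^ 2 * D)
          + (1 - p) * (2 * d * (A + t) ^ 2 + 4 * (A + t) * p ^ 2 * D)
          + p * (1 - p) * ((1 - 2 * p) * D + d * (B - A)) ^ 2)
        - 2 * c * (p * (1 - p) * ((1 - 2 * p) * D + (d + 2) * (B - A))) * D
        + c ^ 2 * D * V := by
    rw [he, hVdef]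
    ring
  have h2 : 1 / (A + t) - 1 / (B + t) = (B - A) / ((A + t) * (B + t)) := by
    field_simp
    ring
  rw [h1, h2, hc]
  generalize (p * (2 * d * (B + t) ^ 2 + 4 * (B + t) * (1 - p) ^ 2 * D)
          + (1 - p) * (2 * d * (A + t) ^ 2 + 4 * (A + t) * p ^ 2 * D)
          + p * (1 - p) * ((1 - 2 * p) * D + d * (B - A)) ^ 2) = W
  generalize (1 - 2 * p) * D + (d + 2) * (B - A) = G
  field_simp
  ring

/-- Isotropic class-conditional Gaussians (Corollary 1 of the paper):
explicit closed-form upper bound on the approximation error `ε_A` of the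
sigmoid-composed-with-affine hypothesis class, as a rational function of the noise
level `σ`. -/
theorem epsA_bound_isotropic_class_conditional_gaussian
    {Ω : Type*} [MeasurableSpace Ω] (μ : Measure Ω) [IsProbabilityMeasure μ]
    {d : ℕ}
    (X : Ω → (Fin d → ℝ)) (S : Ω → ℝ) (Z : Ω → (Fin d → ℝ))
    (hX : Measurable X) (hS : Measurable S) (hZ : Measurable Z)
    (p : ℝ) (hp : p ∈ Set.Ioo (0 : ℝ) 1)
    (hS01 : ∀ ω, S ω = 0 ∨ S ω = 1)
    (hSlaw : μ {ω | S ω = 1} = ENNReal.ofReal p)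
    -- conditional law of X given S = s is N(μ_s, σ_s² I)
    (μ0 μ1 : Fin d → ℝ) (s0 s1 : ℝ) (hs0 : 0 < s0) (hs1 : 0 < s1)
    (hX0 : Measure.map X (μ[|{ω | S ω = 0}])
      = volume.withDensity fun x =>
          ENNReal.ofReal (gaussDensity μ0 (s0 ^ 2 • (1 : Matrix (Fin d) (Fin d) ℝ)) x))
    (hX1 : Measure.map X (μ[|{ω | S ω = 1}])
      = volume.withDensity fun x =>
          ENNReal.ofReal (gaussDensity μ1 (s1 ^ 2 • (1 : Matrix (Fin d) (Fin d) ℝ)) x))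
    (σ : ℝ) (hσ : 0 < σ)
    (hZlaw : Measure.map Z μ = Measure.pi fun _ : Fin d => gaussianReal 0 1)
    (hZindep : IndepFun Z (fun ω => (X ω, S ω)) μ)
    (Xσ : Ω → (Fin d → ℝ)) (hXσ : Xσ = fun ω => X ω + σ • Z ω)
    -- η^σ, a measurable version of the conditional expectation E[S | X^σ]
    (η : (Fin d → ℝ) → ℝ) (hη : Measurable η)
    (hηcond : (fun ω => η (Xσ ω)) =ᵐ[μ] μ[S | MeasurableSpace.comap Xσ inferInstance])
    -- Δ := ‖μ₁ − μ₀‖²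
    (Δ : ℝ) (hΔ : Δ = (μ1 - μ0) ⬝ᵥ (μ1 - μ0))
    -- the coefficients of the bound
    (q1 q2 q3 r1 r2 r3 r4 r5 : ℝ)
    (hq1 : q1 = Δ ^ 2 * (p ^ 2 * (1 - p) * s1 ^ 2 + p * (1 - p) ^ 2 * s0 ^ 2)
      + 2 * (d : ℝ) * s0 ^ 6 - (d : ℝ) ^ 2 * p ^ 3 * (s1 ^ 2 - s0 ^ 2) ^ 3
      + 2 * p * (1 - p) * (2 + (d : ℝ)) * s0 ^ 2 * s1 ^ 2 * Δ
      + p ^ 2 * ((d : ℝ) * (5 * (d : ℝ) - 2) * s0 ^ 4 * s1 ^ 2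
          - 2 * (d : ℝ) * (2 * (d : ℝ) + 1) * s0 ^ 2 * s1 ^ 4
          + (d : ℝ) * (2 + (d : ℝ)) * s1 ^ 6
          - 2 * (d : ℝ) * ((d : ℝ) - 1) * s0 ^ 6)
      + p * ((d : ℝ) * ((d : ℝ) - 4) * s0 ^ 6
          - 2 * (d : ℝ) * ((d : ℝ) - 1) * s0 ^ 4 * s1 ^ 2
          + (d : ℝ) * (2 + (d : ℝ)) * s0 ^ 2 * s1 ^ 4))
    (hq2 : q2 = p * (1 - p) * Δ * (Δ + 2 * (2 + (d : ℝ)) * (s0 ^ 2 + s1 ^ 2))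
      - p ^ 2 * (d : ℝ) * ((d : ℝ) - 4) * (s1 ^ 2 - s0 ^ 2) ^ 2
      + p * ((d : ℝ) * ((d : ℝ) - 10) * s0 ^ 4
          - 2 * (d : ℝ) * ((d : ℝ) - 4) * s0 ^ 2 * s1 ^ 2
          + (d : ℝ) * (2 + (d : ℝ)) * s1 ^ 4)
      + 6 * (d : ℝ) * s0 ^ 4)
    (hq3 : q3 = 2 * p * (1 - p) * (2 + (d : ℝ)) * Δ
      + 6 * (d : ℝ) * (p * s1 ^ 2 + (1 - p) * s0 ^ 2))
    (hr1 : r1 = s0 ^ 4 * s1 ^ 4 * (p * (1 - p) * Δ + p * s1 ^ 2 + (1 - p) * s0 ^ 2))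
    (hr2 : r2 = s0 ^ 2 * s1 ^ 2 * (2 * p * (1 - p) * (s1 ^ 2 + s0 ^ 2) * Δ
      + 2 * p * s1 ^ 4 + 2 * (1 - p) * s0 ^ 4 + 3 * s0 ^ 2 * s1 ^ 2))
    (hr3 : r3 = p * (1 - p) * (s0 ^ 4 + 4 * s0 ^ 2 * s1 ^ 2 + s1 ^ 4) * Δ
      + p * s1 ^ 6 + 3 * (1 + p) * s0 ^ 2 * s1 ^ 4 + 3 * (2 - p) * s0 ^ 4 * s1 ^ 2
      + (1 - p) * s0 ^ 6)
    (hr4 : r4 = 2 * p * (1 - p) * (s1 ^ 2 + s0 ^ 2) * Δ + (2 * p + 1) * s1 ^ 4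
      + (3 - 2 * p) * s0 ^ 4 + 6 * s0 ^ 2 * s1 ^ 2)
    (hr5 : r5 = p * (1 - p) * Δ + (3 - p) * s0 ^ 2 + (2 + p) * s1 ^ 2) :
    (⨅ ab : (Fin d → ℝ) × ℝ,
        ∫ ω, (η (Xσ ω) - 1 / (1 + Real.exp (-(ab.1 ⬝ᵥ Xσ ω + ab.2)))) ^ 2 ∂μ)
      ≤ (s1 ^ 2 - s0 ^ 2) ^ 2
          * (q1 + q2 * σ ^ 2 + q3 * σ ^ 4 + 2 * (d : ℝ) * σ ^ 6)
        / (16 * (r1 + r2 * σ ^ 2 + r3 * σ ^ 4 + r4 * σ ^ 6 + r5 * σ ^ 8 + σ ^ 10)) := by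
  have hΔ0 : 0 ≤ Δ := by
    rw [hΔ]
    exact Finset.sum_nonneg fun i _ ↦ mul_self_nonneg _
  set V1 : ℝ≥0 := .mk (s1 ^ 2) (sq_nonneg s1) + .mk (σ ^ 2) (sq_nonneg σ) with hV1
  set V0 : ℝ≥0 := .mk (s0 ^ 2) (sq_nonneg s0) + .mk (σ ^ 2) (sq_nonneg σ) with hV0
  have hV1c : (V1 : ℝ) = s1 ^ 2 + σ ^ 2 := rfl
  have hV0c : (V0 : ℝ) = s0 ^ 2 + σ ^ 2 := rfl
  have hV1p : 0 < (V1 : ℝ) := by rw [hV1c]; positivity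
  have hV0p : 0 < (V0 : ℝ) := by rw [hV0c]; positivity
  have hq : 0 < 1 - p := sub_pos.2 hp.2
  have hXσm : Measurable Xσ := by rw [hXσ]; fun_prop
  have hN1 : (μ[|{ω | S ω = 1}]).map Xσ = Measure.pi fun i ↦ gaussianReal (μ1 i) V1 := by
    rw [hXσ]; exact map_add_smul_cond hX hS hZ hZlaw hZindep hs1 hX1 σ
  have hN0 : (μ[|{ω | S ω = 0}]).map Xσ = Measure.pi fun i ↦ gaussianReal (μ0 i) V0 := by
    rw [hXσ]; exact map_add_smul_cond hX hS hZ hZlaw hZindep hs0 hX0 σ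
  have hdens1 := pi_gaussianReal_eq_withDensity μ1 (NNReal.coe_ne_zero.1 hV1p.ne')
  have hdens0 := pi_gaussianReal_eq_withDensity μ0 (NNReal.coe_ne_zero.1 hV0p.ne')
  simp only [gaussDensity_smul_one_eq_exp μ1 hV1p] at hdens1
  simp only [gaussDensity_smul_one_eq_exp μ0 hV0p] at hdens0
  set K1 : ℝ := (√((2 * Real.pi) ^ d * (V1 : ℝ) ^ d))⁻¹ with hK1
  set K0 : ℝ := (√((2 * Real.pi) ^ d * (V0 : ℝ) ^ d))⁻¹ with hK0
  have hK1p : 0 < K1 := by positivity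
  have hK0p : 0 < K0 := by positivity
  set θ : (Fin d → ℝ) → ℝ := fun x ↦ Real.log (p * K1) - Real.log ((1 - p) * K0)
    + (x - μ0) ⬝ᵥ (x - μ0) / (2 * V0) - (x - μ1) ⬝ᵥ (x - μ1) / (2 * V1) with hθ
  have hθm : Measurable θ := by fun_prop
  have hη' : (fun ω ↦ η (Xσ ω)) =ᵐ[μ] fun ω ↦ Real.sigmoid (θ (Xσ ω)) := by
    refine hηcond.trans (ae_eq_condExp_of_bayes hS hS01 hp hSlaw hXσm (by fun_prop)
      (by fun_prop) (hN0.trans hdens0) (hN1.trans hdens1) (h := fun x ↦ Real.sigmoid (θ x))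
      (continuous_sigmoid.measurable.comp hθm) (fun x ↦ Real.sigmoid_nonneg _)
      (fun x ↦ Real.sigmoid_le_one _) fun x ↦ ?_).symm
    rw [← ENNReal.ofReal_mul hp.1.le, ← ENNReal.ofReal_mul hq.le,
      ← ENNReal.ofReal_add (by have := hp.1; positivity) (by positivity),
      ← ENNReal.ofReal_mul (by have := hp.1; positivity), ← mul_assoc, ← mul_assoc,
      sigmoid_log_sub_add (mul_pos hp.1 hK1p) (mul_pos hq hK0p)]
  set δ : Fin d → ℝ := μ1 - μ0 with hδ
  set m : Fin d → ℝ := μ0 + p • δ with hm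
  have hμ1 : μ1 = m + (1 - p) • δ := by rw [hm, hδ]; module
  have hμ0 : μ0 = m + (-p) • δ := by rw [hm]; module
  set k : ℝ := 1 / 2 * (1 / V0 - 1 / V1) with hk
  obtain ⟨c, hc⟩ : ∃ c, c = p * (1 - p) * ((1 - 2 * p) * Δ + (d + 2) * (s1 ^ 2 - s0 ^ 2))
      / (p * (s1 ^ 2 + σ ^ 2) + (1 - p) * (s0 ^ 2 + σ ^ 2) + p * (1 - p) * Δ) := ⟨_, rfl⟩
  obtain ⟨e, he⟩ : ∃ e, e = p * ((1 - p) ^ 2 * Δ + d * (s1 ^ 2 + σ ^ 2))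
      + (1 - p) * (p ^ 2 * Δ + d * (s0 ^ 2 + σ ^ 2)) := ⟨_, rfl⟩
  set R : (Fin d → ℝ) → ℝ := fun x ↦ (x - m) ⬝ᵥ (x - m) - c * (δ ⬝ᵥ (x - m)) - e with hR
  obtain ⟨a, β, haβ⟩ : ∃ (a : Fin d → ℝ) (β : ℝ), ∀ x, θ x - (a ⬝ᵥ x + β) = k * R x := by
    refine ⟨(1 / V1 : ℝ) • μ1 - (1 / V0 : ℝ) • μ0 + (2 * k) • m + (k * c) • δ,
      Real.log (p * K1) - Real.log ((1 - p) * K0) + μ0 ⬝ᵥ μ0 / (2 * V0) - μ1 ⬝ᵥ μ1 / (2 * V1)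
        - k * (m ⬝ᵥ m) - k * c * (δ ⬝ᵥ m) + k * e, fun x ↦ ?_⟩
    simp only [hθ, hR, dotProduct_sub, sub_dotProduct, add_dotProduct, smul_dotProduct,
      smul_eq_mul, dotProduct_comm x]
    rw [hk]
    field_simp
    ring
  obtain ⟨hi1, hI1⟩ := integral_residual_sq_pi_gaussianReal V1 m δ (1 - p) c e
  obtain ⟨hi0, hI0⟩ := integral_residual_sq_pi_gaussianReal V0 m δ (-p) c e
  rw [← hμ1, ← hN1] at hi1 hI1
  rw [← hμ0, ← hN0] at hi0 hI0
  rw [← hΔ, hV1c] at hI1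
  rw [← hΔ, hV0c] at hI0
  have hmix := map_eq_mixture hS hS01 hp hSlaw hXσm
  have hRm : Measurable R := by fun_prop
  have hiR : Integrable (fun x ↦ R x ^ 2) (μ.map Xσ) := by
    rw [hmix]
    exact (hi1.smul_measure ENNReal.ofReal_ne_top).add_measure
      (hi0.smul_measure ENNReal.ofReal_ne_top)
  have hIR : ∫ ω, R (Xσ ω) ^ 2 ∂μ = p * ∫ x, R x ^ 2 ∂((μ[|{ω | S ω = 1}]).map Xσ)
      + (1 - p) * ∫ x, R x ^ 2 ∂((μ[|{ω | S ω = 0}]).map Xσ) := by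
    rw [← integral_map (f := fun x ↦ R x ^ 2) hXσm.aemeasurable (by fun_prop), hmix,
      integral_add_measure (hi1.smul_measure ENNReal.ofReal_ne_top)
        (hi0.smul_measure ENNReal.ofReal_ne_top), integral_smul_measure, integral_smul_measure,
      ENNReal.toReal_ofReal hp.1.le, ENNReal.toReal_ofReal hq.le, smul_eq_mul, smul_eq_mul]
  have hbound : ∫ ω, (η (Xσ ω) - 1 / (1 + Real.exp (-(a ⬝ᵥ Xσ ω + β)))) ^ 2 ∂μ
      ≤ 1 / 4 * k ^ 2 * ∫ ω, R (Xσ ω) ^ 2 ∂μ := by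
    rw [← integral_const_mul]
    refine integral_mono_of_nonneg (ae_of_all _ fun ω ↦ sq_nonneg _)
      ((hiR.comp_measurable hXσm).const_mul _) ?_
    filter_upwards [hη'] with ω hω
    rw [hω, one_div (1 + _), ← Real.sigmoid_def]
    refine (sigmoid_sub_sq_le _ _).trans_eq ?_
    rw [haβ]
    ring
  refine (ciInf_le ⟨0, ?_⟩ (a, β)).trans (hbound.trans_eq ?_)
  · rintro _ ⟨ab, rfl⟩
    exact integral_nonneg fun ω ↦ sq_nonneg _
  · rw [hIR, hI1, hI0, hk, hV1c, hV0c, residual_variance_eq_bound hp hΔ0 (pow_pos hs0 2)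
      (pow_pos hs1 2) (pow_pos hσ 2) hc he, hq1, hq2, hq3, hr1, hr2, hr3, hr4, hr5]
    congr 1
    · ring
    · ring
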